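/- Under Assumptions 1 and 3, for any x ∈ ℝ^d, any step size γ with 0 < γ ≤ γ₁ < 1, and any f ∈ C²(ℝ^d, ℝ) with ‖∇f‖ < ∞ and ‖∇²f‖ < ∞, there exists a constant C > 0 independent of γ such that |E f(X_γ^x) − E f(Ỹ_γ^x)| ≤ C(1 + |x|²)(‖∇f‖ + ‖∇²f‖) γ², where (X_t^x) is the Langevin diffusion started at x and Ỹ_γ^x is the one-step Poisson randomized midpoint scheme with step γ. -/

import Mathlib

open MeasureTheory ProbabilityTheory Filter
open scoped ENNReal NNReal RealInnerProductSpace Topology BigOperators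

noncomputable section

/-- Euclidean space `ℝ^d`. -/
abbrev Euc (d : ℕ) : Type := EuclideanSpace ℝ (Fin d)

/-- Assumption 1: `U` is `C¹`, `m`-strongly convex and `L`-gradient Lipschitz
(expressed through the two-sided quadratic bound), with `∇U(0) = 0`. -/
def StrongAssumption {d : ℕ} (U : Euc d → ℝ) (m L : ℝ) : Prop :=
  ContDiff ℝ 1 U ∧ 0 < m ∧ m ≤ L ∧
  (∀ x y : Euc d,
    m / 2 * ‖x - y‖ ^ 2 ≤ U y - U x - ⟪gradient U x, y - x⟫ ∧
    U y - U x - ⟪gradient U x, y - x⟫ ≤ L / 2 * ‖x - y‖ ^ 2) ∧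
  gradient U 0 = 0

/-- Assumption 3: `U` is `C³` with third derivative uniformly bounded by `Lt`. -/
def ThirdDerivBounded {d : ℕ} (U : Euc d → ℝ) (Lt : ℝ) : Prop :=
  ContDiff ℝ 3 U ∧ ∀ x : Euc d, ‖iteratedFDeriv ℝ 3 U x‖ ≤ Lt

/-- The standard Gaussian measure on `ℝ^d`. -/
def stdGaussian (d : ℕ) : Measure (Euc d) :=
  (Measure.pi fun _ : Fin d => ProbabilityTheory.gaussianReal 0 1).map
    ⇑(EuclideanSpace.equiv (Fin d) ℝ).symm

/-- Bernoulli(p) distribution on `ℝ`, giving mass `p` to `1` and `1-p` to `0`. -/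
def bern (p : ℝ≥0∞) : Measure ℝ :=
  p • Measure.dirac (1 : ℝ) + (1 - p) • Measure.dirac (0 : ℝ)

/-- The `i`-th PRLMC midpoint. -/
def prlmcMid {d : ℕ} (U : Euc d → ℝ) (η : ℝ) (K : ℕ) (x : Euc d)
    (g : Fin K → Euc d) (i : Fin K) : Euc d :=
  x - (((i : ℝ) * η / (K : ℝ)) • gradient U x) + Real.sqrt (2 * (i : ℝ) * η / (K : ℝ)) • g i

/-- One step of the PRLMC scheme with step size `η`, Bernoulli variables `h`,
midpoint Gaussians `g` and driving Gaussian `z`. -/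
def prlmcStep {d : ℕ} (U : Euc d → ℝ) (η : ℝ) (K : ℕ) (x : Euc d)
    (h : Fin K → ℝ) (g : Fin K → Euc d) (z : Euc d) : Euc d :=
  x - η • gradient U x
    + η • ∑ i : Fin K, h i • (gradient U x - gradient U (prlmcMid U η K x g i))
    + Real.sqrt (2 * η) • z

/-- The law of the randomness used at a single step of the PRLMC scheme:
`K` i.i.d. Bernoulli(1/K) variables, `K` i.i.d. standard Gaussians for the midpoints
and one standard Gaussian. -/
def prlmcNoise (d K : ℕ) : Measure ((Fin K → ℝ) × (Fin K → Euc d) × Euc d) :=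
  (Measure.pi fun _ : Fin K => bern (K : ℝ≥0∞)⁻¹).prod
    ((Measure.pi fun _ : Fin K => stdGaussian d).prod (stdGaussian d))

/-- The one-step transition kernel `Q_η` of the PRLMC chain. -/
def prlmcKernel {d : ℕ} (U : Euc d → ℝ) (η : ℝ) (K : ℕ) (x : Euc d) : Measure (Euc d) :=
  (prlmcNoise d K).map fun r => prlmcStep U η K x r.1 r.2.1 r.2.2

/-- The law of the PRLMC chain after `n` steps, started from the distribution `μ`. -/
def prlmcIter {d : ℕ} (U : Euc d → ℝ) (η : ℝ) (K : ℕ) (μ : Measure (Euc d)) :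
    ℕ → Measure (Euc d)
  | 0 => μ
  | n + 1 => (prlmcIter U η K μ n).bind (prlmcKernel U η K)

/-- The law of the decreasing-step PRLMC chain after `n` steps (the `(k+1)`-th step uses
step size `γ (k+1)`), started from the distribution `μ`. -/
def prlmcIterVar {d : ℕ} (U : Euc d → ℝ) (K : ℕ) (γ : ℕ → ℝ) (μ : Measure (Euc d)) :
    ℕ → Measure (Euc d)
  | 0 => μ
  | n + 1 => (prlmcIterVar U K γ μ n).bind (prlmcKernel U (γ (n + 1)) K)

/-- Total variation distance. -/
def dTV {d : ℕ} (μ ν : Measure (Euc d)) : ℝ≥0∞ :=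
  ⨆ (A : Set (Euc d)) (_ : MeasurableSet A), max (μ A - ν A) (ν A - μ A)

/-- 2-Wasserstein distance. -/
def W2 {d : ℕ} (μ ν : Measure (Euc d)) : ℝ≥0∞ :=
  ⨅ (π : Measure (Euc d × Euc d)) (_ : π.map Prod.fst = μ ∧ π.map Prod.snd = ν),
    (∫⁻ p, ((‖p.1 - p.2‖₊ : ℝ≥0∞)) ^ 2 ∂π) ^ (1 / 2 : ℝ)

/-- The Gibbs measure `π(dx) ∝ exp(-U(x)) dx`. -/
def gibbs {d : ℕ} (U : Euc d → ℝ) : Measure (Euc d) :=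
  (∫⁻ x, ENNReal.ofReal (Real.exp (-U x)) ∂(volume : Measure (Euc d)))⁻¹ •
    (volume : Measure (Euc d)).withDensity fun x => ENNReal.ofReal (Real.exp (-U x))

/-- Membership in the functional class `𝒢`: `C²` functions with bounded gradient and
bounded Hessian. -/
def MemG {d : ℕ} (h : Euc d → ℝ) : Prop :=
  ContDiff ℝ 2 h ∧ (∃ M, ∀ x, ‖gradient h x‖ ≤ M) ∧
    (∃ M, ∀ x, ‖iteratedFDeriv ℝ 2 h x‖ ≤ M)

/-- The distance `d_𝒢`. -/
def dG {d : ℕ} (μ ν : Measure (Euc d)) : ℝ :=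
  sSup { r : ℝ | ∃ h : Euc d → ℝ, MemG h ∧ r = (∫ x, h x ∂μ) - ∫ x, h x ∂ν }

/-- `B` is a standard `d`-dimensional Brownian motion on `(Ω, P)`. -/
def IsBrownianMotion {Ω : Type} [MeasurableSpace Ω] {d : ℕ} (P : Measure Ω)
    (B : ℝ → Ω → Euc d) : Prop :=
  (∀ t, Measurable (B t)) ∧
  (∀ᵐ ω ∂P, B 0 ω = 0 ∧ Continuous fun t => B t ω) ∧
  (∀ s t : ℝ, 0 ≤ s → s ≤ t →
    Measure.map (fun ω => B t ω - B s ω) P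
      = Measure.map (fun z => Real.sqrt (t - s) • z) (stdGaussian d)) ∧
  (∀ τ : ℕ → ℝ, Monotone τ → 0 ≤ τ 0 →
    iIndepFun (fun i ω => B (τ (i + 1)) ω - B (τ i) ω) P)

/-- `X` is a solution of the Langevin SDE `dX_t = -∇U(X_t) dt + √2 dB_t` started at `x`. -/
def SolvesLangevin {Ω : Type} [MeasurableSpace Ω] {d : ℕ} (U : Euc d → ℝ) (P : Measure Ω)
    (B X : ℝ → Ω → Euc d) (x : Euc d) : Prop :=
  (∀ t, Measurable (X t)) ∧
  ∀ᵐ ω ∂P, (Continuous fun t => X t ω) ∧ ∀ t, 0 ≤ t →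
    X t ω = x - (∫ s in (0:ℝ)..t, gradient U (X s ω)) + Real.sqrt 2 • B t ω

/-- `κ = 2mL/(m+L)`. -/
def kap (m L : ℝ) : ℝ := 2 * m * L / (m + L)

/-- Cumulative times `t_n = γ_1 + ⋯ + γ_n`. -/
def tseq (γ : ℕ → ℝ) (n : ℕ) : ℝ := ∑ k ∈ Finset.Icc 1 n, γ k

/-- The one-step Poisson randomized midpoint scheme `Ỹ_γ^x`, driven by the same Brownian
motion `B` as the diffusion. -/
def oneStepPRLMC {Ω : Type} {d : ℕ} (U : Euc d → ℝ) (γ : ℝ) (K : ℕ) (x : Euc d)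
    (B : ℝ → Ω → Euc d) (H : Fin K → Ω → ℝ) (ξ' : Fin K → Ω → Euc d) (ω : Ω) : Euc d :=
  x - γ • gradient U x
    + γ • ∑ i : Fin K, H i ω •
        (gradient U x - gradient U (prlmcMid U γ K x (fun j => ξ' j ω) i))
    + Real.sqrt 2 • B γ ω



lemma aux_gron (u h : ℝ → ℝ) (hu : Continuous u) (hh : Continuous h) (L γ : ℝ) (hL : 0 ≤ L)
    (hγ : γ ≤ 1) (hh0 : ∀ t ∈ Set.Icc 0 γ, 0 ≤ h t)
    (H : ∀ t ∈ Set.Icc 0 γ, u t ≤ h t + L * ∫ s in (0:ℝ)..t, u s) :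
    ∀ t ∈ Set.Icc 0 γ, ∫ s in (0:ℝ)..t, u s ≤ Real.exp L * ∫ s in (0:ℝ)..t, h s := by
  intro t ht
  set v : ℝ → ℝ := fun t => ∫ s in (0:ℝ)..t, u s with hv
  set w : ℝ → ℝ := fun t => ∫ s in (0:ℝ)..t, h s with hw
  have dv : ∀ t, HasDerivAt v (u t) t := fun t => hu.integral_hasStrictDerivAt 0 t |>.hasDerivAt
  have dw : ∀ t, HasDerivAt w (h t) t := fun t => hh.integral_hasStrictDerivAt 0 t |>.hasDerivAt
  have dF : ∀ t, HasDerivAt (fun t => w t - Real.exp (-(L*t)) * v t)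
      (h t - (Real.exp (-(L*t)) * (-L) * v t + Real.exp (-(L*t)) * u t)) t := by
    intro t
    have h1 : HasDerivAt (fun t => Real.exp (-(L*t))) (Real.exp (-(L*t)) * (-L)) t := by
      have : HasDerivAt (fun t => -(L*t)) (-L) t := by
        have h2 := ((hasDerivAt_id' t).const_mul L).fun_neg
        rwa [mul_one] at h2
      exact this.exp
    exact (dw t).sub (h1.mul (dv t))
  have mono : MonotoneOn (fun t => w t - Real.exp (-(L*t)) * v t) (Set.Icc 0 γ) := by
    apply monotoneOn_of_deriv_nonneg (convex_Icc 0 γ)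
    · exact fun t _ => (dF t).continuousAt.continuousWithinAt
    · exact fun t _ => (dF t).differentiableAt.differentiableWithinAt
    · intro s hs
      rw [interior_Icc] at hs
      have hs' : s ∈ Set.Icc 0 γ := ⟨hs.1.le, hs.2.le⟩
      rw [(dF s).deriv]
      have e1 : Real.exp (-(L*s)) ≤ 1 := Real.exp_le_one_iff.2 (by nlinarith [hs.1])
      have e0 := Real.exp_pos (-(L*s))
      have hH : u s - L * v s ≤ h s := by have := H s hs'; simp only [hv]; linarith
      have := mul_le_mul_of_nonneg_left hH e0.le
      nlinarith [hh0 s hs']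
  have h0 : (0:ℝ) ∈ Set.Icc 0 γ := ⟨le_rfl, ht.1.trans ht.2⟩
  have := mono h0 ht ht.1
  simp only [hv, hw, intervalIntegral.integral_same, mul_zero, sub_zero] at this
  change 0 ≤ w t - Real.exp (-(L*t)) * v t at this
  change v t ≤ Real.exp L * w t
  have hwt : 0 ≤ w t := intervalIntegral.integral_nonneg ht.1
    (fun s hs => hh0 s ⟨hs.1, hs.2.trans ht.2⟩)
  have : v t ≤ Real.exp (L*t) * w t := by
    have e := Real.exp_pos (L*t)
    have h2 : Real.exp (-(L*t)) * v t ≤ w t := by linarith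
    calc v t = Real.exp (L*t) * (Real.exp (-(L*t)) * v t) := by
          rw [← mul_assoc, ← Real.exp_add]; simp
      _ ≤ _ := mul_le_mul_of_nonneg_left h2 e.le
  refine this.trans (mul_le_mul_of_nonneg_right (Real.exp_le_exp.2 ?_) hwt)
  nlinarith [ht.1, ht.2]

lemma aux_cs (h : ℝ → ℝ) (hh : Continuous h) (γ : ℝ) (hγ : 0 < γ) :
    (∫ s in (0:ℝ)..γ, h s) ^ 2 ≤ γ * ∫ s in (0:ℝ)..γ, h s ^ 2 := by
  set c := (∫ s in (0:ℝ)..γ, h s) with hc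
  have h1 : 0 ≤ ∫ s in (0:ℝ)..γ, (γ * h s - c) ^ 2 :=
    intervalIntegral.integral_nonneg hγ.le (fun s _ => sq_nonneg _)
  have h2 : ∫ s in (0:ℝ)..γ, (γ * h s - c) ^ 2
      = γ ^ 2 * (∫ s in (0:ℝ)..γ, h s ^ 2) - 2 * γ * c * c + γ * c ^ 2 := by
    have : ∀ s, (γ * h s - c) ^ 2 = γ ^ 2 * h s ^ 2 - 2 * γ * c * h s + c ^ 2 := fun s => by ring
    simp_rw [this]
    rw [intervalIntegral.integral_add, intervalIntegral.integral_sub,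
      intervalIntegral.integral_const_mul, intervalIntegral.integral_const_mul]
    · simp [hc]
    all_goals exact Continuous.intervalIntegrable (by fun_prop) _ _
  rw [h2] at h1
  have : 0 ≤ γ * (γ * (∫ s in (0:ℝ)..γ, h s ^ 2) - c ^ 2) := by nlinarith
  have := nonneg_of_mul_nonneg_right this hγ
  linarith

section
variable {E F : Type*} [NormedAddCommGroup E] [NormedSpace ℝ E]
  [NormedAddCommGroup F] [NormedSpace ℝ F]

lemma aux_taylor (f : E → F) (hf : ContDiff ℝ 2 f) (M : ℝ)
    (hM : ∀ y, ‖iteratedFDeriv ℝ 2 f y‖ ≤ M) (x u v : E) :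
    ‖f (x + u) - f (x + v) - fderiv ℝ f x (u - v)‖ ≤ M * (‖u‖ + ‖v‖) * ‖u - v‖ := by
  have hd : Differentiable ℝ (fderiv ℝ f) :=
    (hf.fderiv_right (m := 1) (by norm_num)).differentiable (by norm_num)
  have hb : ∀ y, ‖fderiv ℝ (fderiv ℝ f) y‖ ≤ M := by
    intro y
    have := hM y
    rwa [← norm_iteratedFDeriv_fderiv (n := 1), norm_iteratedFDeriv_one] at this
  have hM0 : 0 ≤ M := (norm_nonneg _).trans (hM x)
  have hl : ∀ y, ‖fderiv ℝ f y - fderiv ℝ f x‖ ≤ M * ‖y - x‖ := fun y =>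
    Convex.norm_image_sub_le_of_norm_fderiv_le (fun z _ => hd z) (fun z _ => hb z)
      convex_univ (Set.mem_univ x) (Set.mem_univ y)
  have := Convex.norm_image_sub_le_of_norm_fderiv_le' (𝕜 := ℝ) (f := f) (φ := fderiv ℝ f x)
    (C := M * (‖u‖ + ‖v‖)) (s := Metric.closedBall x (‖u‖ + ‖v‖)) (x := x + v) (y := x + u)
    (fun z _ => hf.differentiable (by norm_num) z)
    (fun z hz => (hl z).trans (by
      gcongr; rwa [← dist_eq_norm])) (convex_closedBall _ _)
    (by simp) (by simp)
  simpa using this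

variable [CompleteSpace E]

set_option maxHeartbeats 2000000 in
lemma aux_pathX (L Lt : ℝ) (hL : 0 ≤ L) (hLt : 0 ≤ Lt) : ∃ c : ℝ, 0 ≤ c ∧
    ∀ (g : E → E) (A : E →L[ℝ] E) (x : E) (γ : ℝ) (b X : ℝ → E),
      (∀ y z, ‖g y - g z‖ ≤ L * ‖y - z‖) → (∀ y, ‖g y‖ ≤ L * ‖y‖) → ‖A‖ ≤ L →
      (∀ y, ‖g y - g x - A (y - x)‖ ≤ Lt * ‖y - x‖ ^ 2) → 0 < γ → γ ≤ 1 →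
      Continuous b → Continuous X → Continuous g →
      (∀ t, 0 ≤ t → X t = x - (∫ s in (0:ℝ)..t, g (X s)) + Real.sqrt 2 • b t) →
      γ * ‖X γ - x‖ ^ 2 ≤ c * ((1 + ‖x‖ ^ 2) * (γ ^ 2 + (∫ s in (0:ℝ)..γ, ‖b s‖ ^ 2) + γ * ‖b γ‖ ^ 2)) ∧
      ‖X γ - (x - γ • g x + Real.sqrt 2 • b γ)‖ ^ 2 ≤ γ *
        (c * ((1 + ‖x‖ ^ 2) * (γ ^ 2 + (∫ s in (0:ℝ)..γ, ‖b s‖ ^ 2) + γ * ‖b γ‖ ^ 2))) ∧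
      ‖X γ - (x - γ • g x + Real.sqrt 2 • b γ) + A (Real.sqrt 2 • ∫ s in (0:ℝ)..γ, b s)‖ ≤
        c * ((1 + ‖x‖ ^ 2) * (γ ^ 2 + (∫ s in (0:ℝ)..γ, ‖b s‖ ^ 2) + γ * ‖b γ‖ ^ 2)) := by
  set k := L * Real.exp L with hk
  set c1 := 2 * L ^ 2 + 4 with hc1
  set c2 := (2 + 2 * k ^ 2) * c1 with hc2
  have hc1' : 0 ≤ c1 := by positivity
  have hc2' : 0 ≤ c2 := by positivity
  refine ⟨(4 * L ^ 2 + 8 + 2 * k ^ 2 * c1) + L ^ 2 * c2 + ((Lt + L ^ 2) * c2 + 2 * L ^ 2),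
    by positivity, ?_⟩
  clear_value k
  intro g A x γ b X gl g0 hA hAt hγ hγ1 hb hX hg hXe
  have s2 : Real.sqrt 2 ^ 2 = 2 := Real.sq_sqrt (by norm_num)
  have s20 : 0 ≤ Real.sqrt 2 := Real.sqrt_nonneg _
  set T := ∫ s in (0:ℝ)..γ, ‖b s‖ ^ 2 with hT
  have hT0 : 0 ≤ T := intervalIntegral.integral_nonneg hγ.le (fun s _ => sq_nonneg _)
  set Q := (1 + ‖x‖ ^ 2) * (γ ^ 2 + T + γ * ‖b γ‖ ^ 2) with hQ
  have hbγ : 0 ≤ γ * ‖b γ‖ ^ 2 := by positivity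
  have q1 : γ ^ 2 * ‖x‖ ^ 2 + γ ^ 2 + T + γ * ‖b γ‖ ^ 2 ≤ Q := by
    have : 0 ≤ ‖x‖ ^ 2 * (T + γ * ‖b γ‖ ^ 2) := by positivity
    rw [hQ]; nlinarith
  have hQ0 : 0 ≤ Q := by positivity
  set u : ℝ → ℝ := fun s => ‖X s - x‖ with hu
  set h : ℝ → ℝ := fun s => L * ‖x‖ * s + Real.sqrt 2 * ‖b s‖ with hh
  have cu : Continuous u := by fun_prop
  have ch : Continuous h := by fun_prop
  have cgX : Continuous fun s => g (X s) := hg.comp hX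
  have u0 : ∀ s, 0 ≤ u s := fun s => norm_nonneg _
  have gX : ∀ s, ‖g (X s)‖ ≤ L * ‖x‖ + L * u s := by
    intro s
    have h1 := gl (X s) x
    have h2 := g0 x
    have h3 := norm_le_norm_add_norm_sub' (g (X s)) (g x)
    simp only [hu]; linarith
  have ints : ∀ t, 0 ≤ t → ‖∫ s in (0:ℝ)..t, g (X s)‖ ≤ L * ‖x‖ * t + L * ∫ s in (0:ℝ)..t, u s := by
    intro t ht
    have := intervalIntegral.norm_integral_le_of_norm_le (μ := volume) ht
      (f := fun s => g (X s)) (g := fun s => L * ‖x‖ + L * u s)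
      (Eventually.of_forall fun s _ => gX s)
      (Continuous.intervalIntegrable (by fun_prop) _ _)
    rw [intervalIntegral.integral_add (Continuous.intervalIntegrable (by fun_prop) _ _)
      (Continuous.intervalIntegrable (by fun_prop) _ _),
      intervalIntegral.integral_const, intervalIntegral.integral_const_mul] at this
    simp only [sub_zero, smul_eq_mul] at this
    linarith
  have uh : ∀ t ∈ Set.Icc 0 γ, u t ≤ h t + L * ∫ s in (0:ℝ)..t, u s := by
    intro t ht
    have e : X t - x = -(∫ s in (0:ℝ)..t, g (X s)) + Real.sqrt 2 • b t := by
      rw [hXe t ht.1]; abel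
    have : u t ≤ ‖∫ s in (0:ℝ)..t, g (X s)‖ + Real.sqrt 2 * ‖b t‖ := by
      simp only [hu, e]
      refine (norm_add_le _ _).trans ?_
      rw [norm_neg, norm_smul, Real.norm_of_nonneg s20]
    have := ints t ht.1
    simp only [hh]; linarith
  have hh0 : ∀ t ∈ Set.Icc 0 γ, 0 ≤ h t := by
    intro t ht
    have := ht.1
    simp only [hh]; positivity
  clear_value h
  have gr := aux_gron u h cu ch L γ hL hγ1 hh0 uh
  set S := ∫ s in (0:ℝ)..γ, h s ^ 2 with hS
  have hS0 : 0 ≤ S := intervalIntegral.integral_nonneg hγ.le (fun s _ => sq_nonneg _)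
  have cs := aux_cs h ch γ hγ
  have hsq : ∀ t ∈ Set.Icc 0 γ, h t ^ 2 ≤ 2 * L ^ 2 * γ ^ 2 * ‖x‖ ^ 2 + 4 * ‖b t‖ ^ 2 := by
    intro t ht
    have h1 : (L * ‖x‖ * t) ^ 2 ≤ (L * ‖x‖ * γ) ^ 2 := by
      have := ht.1; have := ht.2; gcongr
    have h2 : (Real.sqrt 2 * ‖b t‖) ^ 2 = 2 * ‖b t‖ ^ 2 := by rw [mul_pow, s2]
    have := sq_nonneg (L * ‖x‖ * t - Real.sqrt 2 * ‖b t‖)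
    rw [hh]; simp only; nlinarith
  have usq : ∀ t ∈ Set.Icc 0 γ, u t ^ 2 ≤ 2 * h t ^ 2 + 2 * k ^ 2 * (γ * S) := by
    intro t ht
    have hI : ∫ s in (0:ℝ)..t, h s ≤ ∫ s in (0:ℝ)..γ, h s := by
      apply intervalIntegral.integral_mono_interval le_rfl ht.1 ht.2
      · refine (ae_restrict_iff' measurableSet_Ioc).2 (Eventually.of_forall fun s hs => ?_)
        exact hh0 s ⟨hs.1.le, hs.2⟩
      · exact ch.intervalIntegrable _ _
    have h1 : u t ≤ h t + k * ∫ s in (0:ℝ)..γ, h s := by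
      have h2 := uh t ht
      have h3 := gr t ht
      have h4 : L * (∫ s in (0:ℝ)..t, u s) ≤ L * (Real.exp L * ∫ s in (0:ℝ)..γ, h s) := by
        refine mul_le_mul_of_nonneg_left (h3.trans ?_) hL
        exact mul_le_mul_of_nonneg_left hI (Real.exp_pos _).le
      rw [hk]; linarith
    set J := ∫ s in (0:ℝ)..γ, h s
    have h5 : u t ^ 2 ≤ (h t + k * J) ^ 2 := by
      have := u0 t; gcongr
    have h6 : k ^ 2 * J ^ 2 ≤ k ^ 2 * (γ * S) := by gcongr
    nlinarith [sq_nonneg (h t - k * J)]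
  have iS : ∫ s in (0:ℝ)..γ, u s ^ 2 ≤ (2 + 2 * k ^ 2) * S := by
    have h1 : ∫ s in (0:ℝ)..γ, u s ^ 2 ≤ ∫ s in (0:ℝ)..γ, (2 * h s ^ 2 + 2 * k ^ 2 * (γ * S)) := by
      apply intervalIntegral.integral_mono_on hγ.le (Continuous.intervalIntegrable (by fun_prop) _ _)
        (Continuous.intervalIntegrable (by fun_prop) _ _) usq
    rw [intervalIntegral.integral_add (Continuous.intervalIntegrable (by fun_prop) _ _)
      (Continuous.intervalIntegrable (by fun_prop) _ _),
      intervalIntegral.integral_const_mul, intervalIntegral.integral_const] at h1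
    simp only [sub_zero, smul_eq_mul] at h1
    have h2 : γ * (2 * k ^ 2 * (γ * S)) ≤ 2 * k ^ 2 * S := by
      have : γ * γ ≤ 1 := by nlinarith
      have h3 : 0 ≤ 2 * k ^ 2 * S := by positivity
      nlinarith
    linarith
  have SQ : S ≤ c1 * Q := by
    have h1 : S ≤ ∫ s in (0:ℝ)..γ, (2 * L ^ 2 * γ ^ 2 * ‖x‖ ^ 2 + 4 * ‖b s‖ ^ 2) := by
      apply intervalIntegral.integral_mono_on hγ.le (Continuous.intervalIntegrable (by fun_prop) _ _)
        (Continuous.intervalIntegrable (by fun_prop) _ _) hsq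
    rw [intervalIntegral.integral_add (Continuous.intervalIntegrable (by fun_prop) _ _)
      (Continuous.intervalIntegrable (by fun_prop) _ _),
      intervalIntegral.integral_const, intervalIntegral.integral_const_mul] at h1
    simp only [sub_zero, smul_eq_mul] at h1
    have h2 : γ * (2 * L ^ 2 * γ ^ 2 * ‖x‖ ^ 2) ≤ 2 * L ^ 2 * Q := by
      have h3 : γ ^ 2 * ‖x‖ ^ 2 ≤ Q := by nlinarith [sq_nonneg γ]
      have h4 : 0 ≤ 2 * L ^ 2 * (γ ^ 2 * ‖x‖ ^ 2) := by positivity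
      have h5 : 2 * L ^ 2 * (γ ^ 2 * ‖x‖ ^ 2) ≤ 2 * L ^ 2 * Q := by gcongr
      nlinarith
    have h3 : T ≤ Q := by nlinarith [sq_nonneg γ, sq_nonneg (γ * ‖x‖)]
    rw [hc1]; linarith
  have iQ : ∫ s in (0:ℝ)..γ, u s ^ 2 ≤ c2 * Q := by
    refine iS.trans ?_
    rw [hc2, mul_assoc]; gcongr
  have iu0 : 0 ≤ ∫ s in (0:ℝ)..γ, u s ^ 2 :=
    intervalIntegral.integral_nonneg hγ.le (fun s _ => sq_nonneg _)
  have csu := aux_cs u cu γ hγ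
  have a1 : γ * ‖X γ - x‖ ^ 2 ≤ (4 * L ^ 2 + 8 + 2 * k ^ 2 * c1) * Q := by
    have h1 := usq γ ⟨hγ.le, le_rfl⟩
    have h2 := hsq γ ⟨hγ.le, le_rfl⟩
    have h3 : u γ ^ 2 ≤ 4 * L ^ 2 * (γ ^ 2 * ‖x‖ ^ 2) + 8 * ‖b γ‖ ^ 2 + 2 * k ^ 2 * (γ * S) := by
      linarith
    have h4 := mul_le_mul_of_nonneg_left h3 hγ.le
    have h5 : γ * (4 * L ^ 2 * (γ ^ 2 * ‖x‖ ^ 2)) ≤ 4 * L ^ 2 * Q := by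
      have h3 : γ ^ 2 * ‖x‖ ^ 2 ≤ Q := by nlinarith [sq_nonneg γ]
      have h4 : 0 ≤ 4 * L ^ 2 * (γ ^ 2 * ‖x‖ ^ 2) := by positivity
      have h5 : 4 * L ^ 2 * (γ ^ 2 * ‖x‖ ^ 2) ≤ 4 * L ^ 2 * Q := by gcongr
      nlinarith
    have h6 : γ * ‖b γ‖ ^ 2 ≤ Q := by nlinarith [sq_nonneg γ, sq_nonneg (γ * ‖x‖)]
    have h7 : γ * (2 * k ^ 2 * (γ * S)) ≤ 2 * k ^ 2 * c1 * Q := by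
      have : γ * γ ≤ 1 := by nlinarith
      have h3 : 0 ≤ 2 * k ^ 2 * S := by positivity
      have h4 : 2 * k ^ 2 * S ≤ 2 * k ^ 2 * (c1 * Q) := by gcongr
      nlinarith
    change γ * u γ ^ 2 ≤ _
    linarith
  have eD : X γ - (x - γ • g x + Real.sqrt 2 • b γ) = -∫ s in (0:ℝ)..γ, (g (X s) - g x) := by
    rw [hXe γ hγ.le, intervalIntegral.integral_sub (cgX.intervalIntegrable _ _)
      (Continuous.intervalIntegrable (by fun_prop) _ _), intervalIntegral.integral_const]
    simp only [sub_zero]; abel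
  have a2 : ‖X γ - (x - γ • g x + Real.sqrt 2 • b γ)‖ ^ 2 ≤ γ * (L ^ 2 * c2 * Q) := by
    have h1 : ‖X γ - (x - γ • g x + Real.sqrt 2 • b γ)‖ ≤ L * ∫ s in (0:ℝ)..γ, u s := by
      rw [eD, norm_neg, ← intervalIntegral.integral_const_mul]
      exact intervalIntegral.norm_integral_le_of_norm_le hγ.le
        (Eventually.of_forall fun s _ => gl _ _) (Continuous.intervalIntegrable (by fun_prop) _ _)
    calc _ ≤ (L * ∫ s in (0:ℝ)..γ, u s) ^ 2 := by gcongr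
      _ = L ^ 2 * (∫ s in (0:ℝ)..γ, u s) ^ 2 := by ring
      _ ≤ L ^ 2 * (γ * (c2 * Q)) := by
        gcongr; exact csu.trans (by gcongr)
      _ = _ := by ring
  have a3 : ‖X γ - (x - γ • g x + Real.sqrt 2 • b γ) + A (Real.sqrt 2 • ∫ s in (0:ℝ)..γ, b s)‖ ≤
      ((Lt + L ^ 2) * c2 + 2 * L ^ 2) * Q := by
    have e1 : X γ - (x - γ • g x + Real.sqrt 2 • b γ) + A (Real.sqrt 2 • ∫ s in (0:ℝ)..γ, b s)
        = -∫ s in (0:ℝ)..γ, (g (X s) - g x - A (Real.sqrt 2 • b s)) := by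
      rw [eD, intervalIntegral.integral_sub (f := fun s => g (X s) - g x)
        (Continuous.intervalIntegrable (by fun_prop) _ _)
        (Continuous.intervalIntegrable (by fun_prop) _ _),
        ContinuousLinearMap.intervalIntegral_comp_comm A
          (Continuous.intervalIntegrable (by fun_prop) _ _), intervalIntegral.integral_smul]
      abel
    set V := L * ‖x‖ * γ + L * ∫ s in (0:ℝ)..γ, u s with hV
    have h1 : ∀ s ∈ Set.Ioc 0 γ, ‖g (X s) - g x - A (Real.sqrt 2 • b s)‖
        ≤ Lt * u s ^ 2 + L * V := by
      intro s hs
      have e2 : g (X s) - g x - A (Real.sqrt 2 • b s) =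
          (g (X s) - g x - A (X s - x)) + A (-∫ r in (0:ℝ)..s, g (X r)) := by
        have : X s - x = (-∫ r in (0:ℝ)..s, g (X r)) + Real.sqrt 2 • b s := by
          conv_lhs => rw [hXe s hs.1.le]
          abel
        rw [this, map_add]; abel
      rw [e2]
      refine (norm_add_le _ _).trans (add_le_add (hAt _) ?_)
      refine (A.le_opNorm _).trans ?_
      rw [norm_neg]
      refine mul_le_mul hA ?_ (norm_nonneg _) hL
      refine (ints s hs.1.le).trans ?_
      have hI : ∫ s in (0:ℝ)..s, u s ≤ ∫ s in (0:ℝ)..γ, u s := by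
        apply intervalIntegral.integral_mono_interval le_rfl hs.1.le hs.2
        · exact Eventually.of_forall u0
        · exact cu.intervalIntegrable _ _
      have := hs.2
      rw [hV]; gcongr
    have h2 : ‖X γ - (x - γ • g x + Real.sqrt 2 • b γ) + A (Real.sqrt 2 • ∫ s in (0:ℝ)..γ, b s)‖ ≤
        Lt * (∫ s in (0:ℝ)..γ, u s ^ 2) + γ * (L * V) := by
      rw [e1, norm_neg]
      have := intervalIntegral.norm_integral_le_of_norm_le (μ := volume) hγ.le
        (Eventually.of_forall h1) (Continuous.intervalIntegrable (by fun_prop) _ _)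
      rwa [intervalIntegral.integral_add (Continuous.intervalIntegrable (by fun_prop) _ _)
        (Continuous.intervalIntegrable (by fun_prop) _ _),
        intervalIntegral.integral_const_mul, intervalIntegral.integral_const, sub_zero,
        smul_eq_mul] at this
    have h3 : ∫ s in (0:ℝ)..γ, u s ≤ γ + ∫ s in (0:ℝ)..γ, u s ^ 2 := by
      have h1 : ∫ s in (0:ℝ)..γ, u s ≤ ∫ s in (0:ℝ)..γ, (1 + u s ^ 2) := by
        apply intervalIntegral.integral_mono_on hγ.le
          (Continuous.intervalIntegrable (by fun_prop) _ _)
          (Continuous.intervalIntegrable (by fun_prop) _ _)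
        intro s _
        nlinarith [sq_nonneg (u s - 1), u0 s]
      rwa [intervalIntegral.integral_add (Continuous.intervalIntegrable (by fun_prop) _ _)
        (Continuous.intervalIntegrable (by fun_prop) _ _), intervalIntegral.integral_const,
        sub_zero, smul_eq_mul, mul_one] at h1
    have h4 : γ * (L * V) ≤ L ^ 2 * (2 * Q + c2 * Q) := by
      have e : γ * (L * V) = L ^ 2 * (γ ^ 2 * ‖x‖ + γ * ∫ s in (0:ℝ)..γ, u s) := by
        rw [hV]; ring
      rw [e]
      have h5 : γ * ∫ s in (0:ℝ)..γ, u s ≤ γ ^ 2 + c2 * Q := by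
        have := mul_le_mul_of_nonneg_left h3 hγ.le
        nlinarith
      have h6 : γ ^ 2 * ‖x‖ ≤ γ ^ 2 * (1 + ‖x‖ ^ 2) := by
        gcongr; nlinarith [sq_nonneg (‖x‖ - 1), norm_nonneg x]
      have h7 : γ ^ 2 * ‖x‖ + γ * ∫ s in (0:ℝ)..γ, u s ≤ 2 * Q + c2 * Q := by
        nlinarith [sq_nonneg (γ * ‖x‖)]
      gcongr
    have h5 : Lt * (∫ s in (0:ℝ)..γ, u s ^ 2) ≤ Lt * (c2 * Q) := by gcongr
    linarith
  have p1 : 0 ≤ (4 * L ^ 2 + 8 + 2 * k ^ 2 * c1) * Q := by positivity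
  have p2 : 0 ≤ L ^ 2 * c2 * Q := by positivity
  have p3 : 0 ≤ ((Lt + L ^ 2) * c2 + 2 * L ^ 2) * Q := by positivity
  refine ⟨by linarith, a2.trans ?_, by linarith⟩
  refine mul_le_mul_of_nonneg_left ?_ hγ.le
  linarith
end

section
variable {E F : Type*} [NormedAddCommGroup E] [NormedSpace ℝ E]
  [NormedAddCommGroup F] [NormedSpace ℝ F]

set_option maxHeartbeats 2000000 in
lemma aux_stepY (K : ℕ) (L Lt : ℝ) (hL : 0 ≤ L) (hLt : 0 ≤ Lt) : ∃ c : ℝ, 0 ≤ c ∧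
    ∀ (g : E → E) (A : E →L[ℝ] E) (x : E) (γ : ℝ) (b : E) (h : Fin K → ℝ) (ξ : Fin K → E)
      (w : Fin K → E) (DY : E) (Q : ℝ),
      (∀ y z, ‖g y - g z‖ ≤ L * ‖y - z‖) → (∀ y, ‖g y‖ ≤ L * ‖y‖) → ‖A‖ ≤ L →
      (∀ y, ‖g y - g x - A (y - x)‖ ≤ Lt * ‖y - x‖ ^ 2) → 0 < γ → γ ≤ 1 →
      (∀ i, |h i| ≤ 1) →
      (∀ i, w i = x - (((i : ℝ) * γ / (K : ℝ)) • g x) + Real.sqrt (2 * (i : ℝ) * γ / (K : ℝ)) • ξ i) →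
      DY = γ • ∑ i, h i • (g x - g (w i)) →
      (1 + ‖x‖ ^ 2) * (γ ^ 2 + γ * ‖b‖ ^ 2 + γ ^ 2 * ∑ i, ‖ξ i‖ ^ 2) ≤ Q →
      γ * ‖x - γ • g x + DY + Real.sqrt 2 • b - x‖ ^ 2 ≤ c * Q ∧
      ‖DY‖ ^ 2 ≤ γ * (c * Q) ∧
      ‖DY + A (∑ i : Fin K, (γ * Real.sqrt (2 * (i : ℝ) * γ / (K : ℝ))) • h i • ξ i)‖ ≤ c * Q := by
  set c2 := 2 * K * L ^ 2 + 4 with hc2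
  have hc2' : 0 ≤ c2 := by positivity
  refine ⟨3 * (L ^ 2 + L ^ 2 * K * c2 + 2) + L ^ 2 * K * c2 + (Lt * c2 + K * L ^ 2),
    by positivity, ?_⟩
  clear_value c2
  intro g A x γ b h ξ w DY Q gl g0 hA hAt hγ hγ1 hh hw hDY hQ
  have s2 : Real.sqrt 2 ^ 2 = 2 := Real.sq_sqrt (by norm_num)
  have s20 : 0 ≤ Real.sqrt 2 := Real.sqrt_nonneg _
  set Z := ∑ i, ‖ξ i‖ ^ 2 with hZ
  have hZ0 : 0 ≤ Z := Finset.sum_nonneg fun i _ => sq_nonneg _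
  clear_value Z
  have q1 : γ ^ 2 * ‖x‖ ^ 2 + γ ^ 2 + γ * ‖b‖ ^ 2 + γ ^ 2 * Z ≤ Q := by
    have : 0 ≤ ‖x‖ ^ 2 * (γ * ‖b‖ ^ 2 + γ ^ 2 * Z) := by positivity
    nlinarith
  have b1 : 0 ≤ γ ^ 2 * ‖x‖ ^ 2 := by positivity
  have b2 : 0 ≤ γ ^ 2 := by positivity
  have b3 : 0 ≤ γ * ‖b‖ ^ 2 := by positivity
  have b4 : 0 ≤ γ ^ 2 * Z := by positivity
  have hQ0 : 0 ≤ Q := by linarith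
  have th : ∀ i : Fin K, 0 ≤ (i : ℝ) * γ / K ∧ (i : ℝ) * γ / K ≤ γ := by
    intro i
    have hi : (i : ℝ) ≤ K := by exact_mod_cast i.2.le
    have hK : (0:ℝ) < K := by exact_mod_cast (Nat.zero_le _).trans_lt i.2
    refine ⟨by positivity, ?_⟩
    rw [div_le_iff₀ hK]; nlinarith
  have gx := g0 x
  have w1 : ∀ i, ‖w i - x‖ ^ 2 ≤ 2 * L ^ 2 * (γ ^ 2 * ‖x‖ ^ 2) + 4 * γ * ‖ξ i‖ ^ 2 := by
    intro i
    obtain ⟨t0, t1⟩ := th i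
    have e : w i - x = -((((i : ℝ) * γ / (K : ℝ)) • g x)) +
        Real.sqrt (2 * (i : ℝ) * γ / (K : ℝ)) • ξ i := by rw [hw i]; abel
    have e2 : Real.sqrt (2 * (i : ℝ) * γ / (K : ℝ)) ^ 2 ≤ 2 * γ := by
      rw [Real.sq_sqrt (by have : 2 * (i : ℝ) * γ / (K : ℝ) = 2 * ((i : ℝ) * γ / K) := by ring
                           rw [this]; positivity)]
      have : 2 * (i : ℝ) * γ / (K : ℝ) = 2 * ((i : ℝ) * γ / K) := by ring
      linarith
    have n1 : ‖w i - x‖ ≤ γ * (L * ‖x‖) + Real.sqrt (2 * (i : ℝ) * γ / (K : ℝ)) * ‖ξ i‖ := by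
      rw [e]
      refine (norm_add_le _ _).trans ?_
      rw [norm_neg, norm_smul, norm_smul, Real.norm_of_nonneg t0,
        Real.norm_of_nonneg (Real.sqrt_nonneg _)]
      gcongr
    set r := Real.sqrt (2 * (i : ℝ) * γ / (K : ℝ))
    have n2 : ‖w i - x‖ ^ 2 ≤ (γ * (L * ‖x‖) + r * ‖ξ i‖) ^ 2 := by gcongr
    have n3 : r ^ 2 * ‖ξ i‖ ^ 2 ≤ 2 * γ * ‖ξ i‖ ^ 2 := by gcongr
    nlinarith [sq_nonneg (γ * (L * ‖x‖) - r * ‖ξ i‖)]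
  have w2 : γ * ∑ i, ‖w i - x‖ ^ 2 ≤ c2 * Q := by
    have : ∑ i, ‖w i - x‖ ^ 2 ≤ ∑ i, (2 * L ^ 2 * (γ ^ 2 * ‖x‖ ^ 2) + 4 * γ * ‖ξ i‖ ^ 2) :=
      Finset.sum_le_sum fun i _ => w1 i
    rw [Finset.sum_add_distrib, ← Finset.mul_sum (f := fun i => ‖ξ i‖ ^ 2)] at this
    simp only [Finset.sum_const, Finset.card_univ, Fintype.card_fin, nsmul_eq_mul] at this
    have h2 := mul_le_mul_of_nonneg_left this hγ.le
    have h3 : γ * (K * (2 * L ^ 2 * (γ ^ 2 * ‖x‖ ^ 2))) ≤ 2 * K * L ^ 2 * Q := by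
      have h4 : γ * (γ ^ 2 * ‖x‖ ^ 2) ≤ Q := by nlinarith
      have : 2 * K * L ^ 2 * (γ * (γ ^ 2 * ‖x‖ ^ 2)) ≤ 2 * K * L ^ 2 * Q := by gcongr
      linarith
    rw [← hZ] at h2
    rw [hc2]; linarith
  have nD : ‖DY‖ ^ 2 ≤ γ * (L ^ 2 * K * c2 * Q) := by
    have h1 : ‖DY‖ ≤ γ * ∑ i, L * ‖w i - x‖ := by
      rw [hDY, norm_smul, Real.norm_of_nonneg hγ.le]
      gcongr
      refine norm_sum_le_of_le _ fun i _ => ?_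
      rw [norm_smul, Real.norm_eq_abs]
      have h2 := gl x (w i)
      rw [norm_sub_rev x] at h2
      nlinarith [hh i, abs_nonneg (h i), norm_nonneg (g x - g (w i))]
    have h2 : (∑ i, L * ‖w i - x‖) ^ 2 ≤ K * (L ^ 2 * ∑ i, ‖w i - x‖ ^ 2) := by
      have := sq_sum_le_card_mul_sum_sq (s := Finset.univ) (f := fun i => L * ‖w i - x‖)
      simp only [Finset.card_univ, Fintype.card_fin, mul_pow] at this
      rwa [← Finset.mul_sum (f := fun i => ‖w i - x‖ ^ 2)] at this
    calc ‖DY‖ ^ 2 ≤ (γ * ∑ i, L * ‖w i - x‖) ^ 2 := by gcongr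
      _ = γ ^ 2 * (∑ i, L * ‖w i - x‖) ^ 2 := by ring
      _ ≤ γ ^ 2 * (K * (L ^ 2 * ∑ i, ‖w i - x‖ ^ 2)) := by gcongr
      _ = γ * (L ^ 2 * K * (γ * ∑ i, ‖w i - x‖ ^ 2)) := by ring
      _ ≤ γ * (L ^ 2 * K * (c2 * Q)) := by gcongr
      _ = _ := by ring
  have p2 : 0 ≤ L ^ 2 * K * c2 * Q := by positivity
  have a1 : γ * ‖x - γ • g x + DY + Real.sqrt 2 • b - x‖ ^ 2
      ≤ 3 * (L ^ 2 + L ^ 2 * K * c2 + 2) * Q := by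
    have e : x - γ • g x + DY + Real.sqrt 2 • b - x = -(γ • g x) + DY + Real.sqrt 2 • b := by abel
    have n1 : ‖x - γ • g x + DY + Real.sqrt 2 • b - x‖
        ≤ γ * (L * ‖x‖) + ‖DY‖ + Real.sqrt 2 * ‖b‖ := by
      rw [e]
      refine (norm_add₃_le).trans ?_
      rw [norm_neg, norm_smul, norm_smul, Real.norm_of_nonneg hγ.le, Real.norm_of_nonneg s20]
      gcongr
    have n2 : ‖x - γ • g x + DY + Real.sqrt 2 • b - x‖ ^ 2
        ≤ (γ * (L * ‖x‖) + ‖DY‖ + Real.sqrt 2 * ‖b‖) ^ 2 := by gcongr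
    have n3 : (γ * (L * ‖x‖) + ‖DY‖ + Real.sqrt 2 * ‖b‖) ^ 2 ≤
        3 * (L ^ 2 * (γ ^ 2 * ‖x‖ ^ 2) + ‖DY‖ ^ 2 + 2 * ‖b‖ ^ 2) := by
      have : (Real.sqrt 2 * ‖b‖) ^ 2 = 2 * ‖b‖ ^ 2 := by rw [mul_pow, s2]
      nlinarith [sq_nonneg (γ * (L * ‖x‖) - ‖DY‖), sq_nonneg (‖DY‖ - Real.sqrt 2 * ‖b‖),
        sq_nonneg (γ * (L * ‖x‖) - Real.sqrt 2 * ‖b‖)]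
    have n4 := mul_le_mul_of_nonneg_left (n2.trans n3) hγ.le
    have m1 : γ * (L ^ 2 * (γ ^ 2 * ‖x‖ ^ 2)) ≤ L ^ 2 * Q := by
      have h4 : γ * (γ ^ 2 * ‖x‖ ^ 2) ≤ Q := by nlinarith
      have : L ^ 2 * (γ * (γ ^ 2 * ‖x‖ ^ 2)) ≤ L ^ 2 * Q := by gcongr
      linarith
    have m2 : γ * ‖DY‖ ^ 2 ≤ L ^ 2 * K * c2 * Q := by
      have : γ * γ ≤ 1 := by nlinarith
      nlinarith
    linarith
  have a3 : ‖DY + A (∑ i : Fin K, (γ * Real.sqrt (2 * (i : ℝ) * γ / (K : ℝ))) • h i • ξ i)‖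
      ≤ (Lt * c2 + K * L ^ 2) * Q := by
    have e : DY + A (∑ i : Fin K, (γ * Real.sqrt (2 * (i : ℝ) * γ / (K : ℝ))) • h i • ξ i) =
        γ • ∑ i, h i • (-(g (w i) - g x - A (w i - x)) + ((i : ℝ) * γ / (K : ℝ)) • A (g x)) := by
      rw [hDY, map_sum, Finset.smul_sum, Finset.smul_sum, ← Finset.sum_add_distrib]
      refine Finset.sum_congr rfl fun i _ => ?_
      have e : w i - x = -((((i : ℝ) * γ / (K : ℝ)) • g x)) +
        Real.sqrt (2 * (i : ℝ) * γ / (K : ℝ)) • ξ i := by rw [hw i]; abel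
      rw [e]
      simp only [map_add, map_neg, map_smul]
      module
    have n1 : ‖DY + A (∑ i : Fin K, (γ * Real.sqrt (2 * (i : ℝ) * γ / (K : ℝ))) • h i • ξ i)‖ ≤
        γ * ∑ i, (Lt * ‖w i - x‖ ^ 2 + γ * (L * (L * ‖x‖))) := by
      rw [e, norm_smul, Real.norm_of_nonneg hγ.le]
      gcongr
      refine norm_sum_le_of_le _ fun i _ => ?_
      rw [norm_smul, Real.norm_eq_abs]
      have h2 : ‖-(g (w i) - g x - A (w i - x)) + ((i : ℝ) * γ / (K : ℝ)) • A (g x)‖ ≤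
          Lt * ‖w i - x‖ ^ 2 + γ * (L * (L * ‖x‖)) := by
        refine (norm_add_le _ _).trans ?_
        rw [norm_neg, norm_smul, Real.norm_of_nonneg (th i).1]
        refine add_le_add (hAt _) ?_
        have : ‖A (g x)‖ ≤ L * (L * ‖x‖) := (A.le_opNorm _).trans (by gcongr)
        exact mul_le_mul (th i).2 this (norm_nonneg _) hγ.le
      exact (mul_le_of_le_one_left (norm_nonneg _) (hh i)).trans h2
    rw [Finset.sum_add_distrib, ← Finset.mul_sum (f := fun i => ‖w i - x‖ ^ 2)] at n1
    simp only [Finset.sum_const, Finset.card_univ, Fintype.card_fin, nsmul_eq_mul] at n1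
    have n2 : Lt * (γ * ∑ i, ‖w i - x‖ ^ 2) ≤ Lt * (c2 * Q) := by gcongr
    have n3 : K * L ^ 2 * (γ ^ 2 * ‖x‖) ≤ K * L ^ 2 * Q := by
      have h6 : γ ^ 2 * ‖x‖ ≤ γ ^ 2 * (1 + ‖x‖ ^ 2) := by
        gcongr; nlinarith [sq_nonneg (‖x‖ - 1), norm_nonneg x]
      have : γ ^ 2 * ‖x‖ ≤ Q := by linarith
      gcongr
    linarith
  have p1 : 0 ≤ 3 * (L ^ 2 + L ^ 2 * K * c2 + 2) * Q := by positivity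
  have p3 : 0 ≤ (Lt * c2 + K * L ^ 2) * Q := by positivity
  refine ⟨by linarith, nD.trans ?_, by linarith⟩
  refine mul_le_mul_of_nonneg_left ?_ hγ.le
  linarith
end

section
variable {E : Type*} [NormedAddCommGroup E] [NormedSpace ℝ E]

lemma aux_comb (f : E → ℝ) (hf : ContDiff ℝ 2 f) (M1 M2 : ℝ)
    (h1 : ∀ y, ‖fderiv ℝ f y‖ ≤ M1)
    (h2 : ∀ y, ‖iteratedFDeriv ℝ 2 f y‖ ≤ M2) (x X Y Z DX DY N1 N2 : E) (γ R : ℝ) (hγ : 0 < γ)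
    (hX : γ * ‖X - x‖ ^ 2 ≤ R) (hY : γ * ‖Y - x‖ ^ 2 ≤ R)
    (hDX : ‖DX‖ ^ 2 ≤ γ * R) (hDY : ‖DY‖ ^ 2 ≤ γ * R) (eX : X = Z + DX) (eY : Y = Z + DY)
    (hNX : ‖DX + N1‖ ≤ R) (hNY : ‖DY + N2‖ ≤ R) :
    |f X - f Y - fderiv ℝ f x (N2 - N1)| ≤ 5 * (M1 + M2) * R := by
  have hM1 : 0 ≤ M1 := (norm_nonneg _).trans (h1 x)
  have hM2 : 0 ≤ M2 := (norm_nonneg _).trans (h2 x)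
  have hR : 0 ≤ R := (norm_nonneg _).trans hNX
  have t := aux_taylor f hf M2 h2 x (X - x) (Y - x)
  rw [add_sub_cancel, add_sub_cancel, sub_sub_sub_cancel_right] at t
  have eD : X - Y = DX - DY := by rw [eX, eY]; abel
  have b1 : M2 * (‖X - x‖ + ‖Y - x‖) * ‖X - Y‖ ≤ M2 * (5 * R) := by
    rw [mul_assoc]
    refine mul_le_mul_of_nonneg_left ?_ hM2
    have n : ‖X - Y‖ ^ 2 ≤ γ * (4 * R) := by
      have : ‖X - Y‖ ≤ ‖DX‖ + ‖DY‖ := by rw [eD]; exact norm_sub_le _ _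
      have : ‖X - Y‖ ^ 2 ≤ (‖DX‖ + ‖DY‖) ^ 2 := by gcongr
      nlinarith [sq_nonneg (‖DX‖ - ‖DY‖)]
    set a := ‖X - x‖
    set b := ‖Y - x‖
    set D := ‖X - Y‖
    have k1 : γ * ((a + b) * D) ≤ γ * (5 * R) := by
      nlinarith [sq_nonneg (γ * a - D), sq_nonneg (γ * b - D)]
    exact le_of_mul_le_mul_left k1 hγ
  have b2 : |fderiv ℝ f x (X - Y) - fderiv ℝ f x (N2 - N1)| ≤ M1 * (2 * R) := by
    rw [← map_sub, ← Real.norm_eq_abs]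
    refine (ContinuousLinearMap.le_opNorm _ _).trans ?_
    refine mul_le_mul (h1 x) ?_ (norm_nonneg _) hM1
    have : X - Y - (N2 - N1) = (DX + N1) - (DY + N2) := by rw [eD]; abel
    rw [this]
    refine (norm_sub_le _ _).trans ?_
    linarith
  rw [Real.norm_eq_abs] at t
  have := abs_add_le (f X - f Y - fderiv ℝ f x (X - Y)) (fderiv ℝ f x (X - Y) - fderiv ℝ f x (N2 - N1))
  rw [sub_add_sub_cancel] at this
  have : 0 ≤ M1 * R := by positivity
  have : 0 ≤ M2 * R := by positivity
  linarith

lemma aux_lip (f : E → ℝ) (hf : ContDiff ℝ 2 f) (M1 : ℝ)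
    (h1 : ∀ y, ‖fderiv ℝ f y‖ ≤ M1) (x X : E) (γ R : ℝ) (hγ : 0 < γ)
    (hX : γ * ‖X - x‖ ^ 2 ≤ R) : ‖f X‖ ≤ ‖f x‖ + M1 * (1 + R / γ) := by
  have hM1 : 0 ≤ M1 := (norm_nonneg _).trans (h1 x)
  have := Convex.norm_image_sub_le_of_norm_fderiv_le (𝕜 := ℝ) (f := f)
    (fun z _ => hf.differentiable (by norm_num) z) (fun z _ => h1 z)
      convex_univ (Set.mem_univ x) (Set.mem_univ X)
  have h2 : ‖X - x‖ ^ 2 ≤ R / γ := by rw [le_div_iff₀ hγ]; linarith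
  have h3 : ‖X - x‖ ≤ 1 + R / γ := by nlinarith [sq_nonneg (‖X - x‖ - 1), norm_nonneg (X - x)]
  have h4 := norm_le_norm_add_norm_sub' (f X) (f x)
  have : M1 * ‖X - x‖ ≤ M1 * (1 + R / γ) := by gcongr
  linarith
end

section
variable {E : Type*} [NormedAddCommGroup E] [InnerProductSpace ℝ E] [CompleteSpace E]

lemma aux_grad_norm (f : E → ℝ) (y : E) : ‖fderiv ℝ f y‖ = ‖gradient f y‖ := by
  simp [gradient]

lemma aux_grad_lip (U : E → ℝ) (m L : ℝ) (hm : 0 < m) (hmL : m ≤ L)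
    (h : ∀ x y : E,
    m / 2 * ‖x - y‖ ^ 2 ≤ U y - U x - ⟪gradient U x, y - x⟫ ∧
    U y - U x - ⟪gradient U x, y - x⟫ ≤ L / 2 * ‖x - y‖ ^ 2) (x y : E) :
    ‖gradient U y - gradient U x‖ ≤ L * ‖y - x‖ := by
  have hL : 0 < L := hm.trans_le hmL
  set δ := gradient U y - gradient U x with hδ
  set z := y - (1 / L) • δ with hz
  have h1 := (h x z).1
  have h2 := (h y z).2
  have h3 := (h x y).2
  have h4 : 0 ≤ m / 2 * ‖x - z‖ ^ 2 := by positivity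
  have e1 : y - z = (1 / L) • δ := by rw [hz]; abel
  have e2 : ⟪gradient U y, z - y⟫ = ⟪gradient U x, z - x⟫ - ⟪gradient U x, y - x⟫
      - (1 / L) * ‖δ‖ ^ 2 := by
    have : z - x = (z - y) + (y - x) := by abel
    rw [this, inner_add_right, add_sub_cancel_right]
    have e3 : ⟪δ, z - y⟫ = - ((1 / L) * ‖δ‖ ^ 2) := by
      rw [← neg_sub y z, e1, inner_neg_right, real_inner_smul_right, real_inner_self_eq_norm_sq]
    have : gradient U y = δ + gradient U x := by rw [hδ]; abel
    rw [this, inner_add_left, e3]; ring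
  rw [e1, norm_smul, Real.norm_of_nonneg (by positivity), e2] at h2
  rw [norm_sub_rev] at h3
  have e4 : L / 2 * (1 / L * ‖δ‖) ^ 2 = (1 / L) * ‖δ‖ ^ 2 / 2 := by field_simp
  rw [e4] at h2
  have h5 : (1 / L) * ‖δ‖ ^ 2 ≤ L * ‖y - x‖ ^ 2 := by linarith
  have h6 : ‖δ‖ ^ 2 ≤ (L * ‖y - x‖) ^ 2 := by
    have := mul_le_mul_of_nonneg_left h5 hL.le
    have e5 : L * (1 / L * ‖δ‖ ^ 2) = ‖δ‖ ^ 2 := by field_simp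
    nlinarith
  exact le_of_sq_le_sq h6 (by positivity)

lemma aux_grad_taylor (U : E → ℝ) (Lt L : ℝ) (hL : 0 ≤ L) (hU : ContDiff ℝ 3 U)
    (hb : ∀ x, ‖iteratedFDeriv ℝ 3 U x‖ ≤ Lt)
    (hl : ∀ y z, ‖gradient U y - gradient U z‖ ≤ L * ‖y - z‖) (x : E) :
    ∃ A : E →L[ℝ] E, ‖A‖ ≤ L ∧
      ∀ y, ‖gradient U y - gradient U x - A (y - x)‖ ≤ Lt * ‖y - x‖ ^ 2 := by
  have hd : ContDiff ℝ 2 (fderiv ℝ U) := hU.fderiv_right (m := 2) (by norm_num)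
  have hn : ∀ y, ‖iteratedFDeriv ℝ 2 (fderiv ℝ U) y‖ ≤ Lt := by
    intro y; rw [norm_iteratedFDeriv_fderiv]; exact hb y
  let J : StrongDual ℝ E →L[ℝ] E :=
    LinearMap.mkContinuous
      { toFun := fun l => (InnerProductSpace.toDual ℝ E).symm l
        map_add' := fun a b => map_add _ a b
        map_smul' := fun a b => by simp } 1 (fun l => by simp)
  have hJ : ∀ l, ‖J l‖ = ‖l‖ := fun l => (InnerProductSpace.toDual ℝ E).symm.norm_map l
  have hg : ∀ y, gradient U y = J (fderiv ℝ U y) := fun y => rfl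
  refine ⟨J ∘L fderiv ℝ (fderiv ℝ U) x, ?_, ?_⟩
  · refine (ContinuousLinearMap.opNorm_le_bound _ (norm_nonneg _) fun v => ?_).trans
      (norm_fderiv_le_of_lipschitz ℝ (f := fderiv ℝ U) (C := ⟨L, hL⟩) (x₀ := x) ?_)
    · rw [ContinuousLinearMap.comp_apply, hJ]; exact ContinuousLinearMap.le_opNorm _ _
    · refine LipschitzWith.of_dist_le_mul fun y z => ?_
      have := hl y z
      rw [hg, hg, ← map_sub, hJ] at this
      rw [dist_eq_norm, dist_eq_norm]; exact this
  · intro y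
    rw [hg, hg, ContinuousLinearMap.comp_apply, ← map_sub, ← map_sub, hJ]
    have := aux_taylor (fderiv ℝ U) hd Lt hn x (y - x) 0
    simp only [add_sub_cancel, add_zero, sub_zero, norm_zero] at this
    calc _ ≤ _ := this
      _ = _ := by ring
end


lemma aux_gauss_eq (d : ℕ) :
    _root_.stdGaussian d = ProbabilityTheory.stdGaussian (EuclideanSpace ℝ (Fin d)) := by
  rw [← map_pi_eq_stdGaussian]
  rfl

instance aux_gauss_prob (d : ℕ) : IsProbabilityMeasure (_root_.stdGaussian d) := by
  rw [aux_gauss_eq]; infer_instance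

lemma aux_gauss_sq (d : ℕ) : Integrable (fun z : Euc d => ‖z‖ ^ 2) (_root_.stdGaussian d) := by
  rw [aux_gauss_eq]
  have := IsGaussian.memLp_two_id (μ := ProbabilityTheory.stdGaussian (EuclideanSpace ℝ (Fin d)))
  exact this.integrable_norm_pow (by norm_num)

lemma aux_gauss_mean (d : ℕ) (l : Euc d →L[ℝ] ℝ) : ∫ z, l z ∂(_root_.stdGaussian d) = 0 := by
  rw [aux_gauss_eq]
  exact integral_strongDual_stdGaussian l

lemma aux_gauss_lin (d : ℕ) (l : Euc d →L[ℝ] ℝ) : Integrable l (_root_.stdGaussian d) := by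
  rw [aux_gauss_eq]
  exact l.integrable_comp IsGaussian.integrable_id

section
variable {Ω : Type} [MeasurableSpace Ω] {d : ℕ} {P : Measure Ω} {B : ℝ → Ω → Euc d}

lemma aux_bm_law (hB : IsBrownianMotion P B) (t : ℝ) (ht : 0 ≤ t) :
    Measure.map (B t) P = Measure.map (fun z => Real.sqrt t • z) (_root_.stdGaussian d) := by
  obtain ⟨h1, h2, h3, h4⟩ := hB
  have := h3 0 t le_rfl ht
  rw [sub_zero] at this
  rw [← this]
  apply Measure.map_congr
  filter_upwards [h2] with ω hω
  rw [hω.1, sub_zero]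

lemma aux_bm_int (hB : IsBrownianMotion P B) (t : ℝ) (ht : 0 ≤ t) (φ : Euc d → ℝ)
    (hφ : Continuous φ) :
    ∫ ω, φ (B t ω) ∂P = ∫ z, φ (Real.sqrt t • z) ∂(_root_.stdGaussian d) := by
  rw [← integral_map (hB.1 t).aemeasurable (f := φ) hφ.aestronglyMeasurable, aux_bm_law hB t ht,
    integral_map (by fun_prop) hφ.aestronglyMeasurable]

lemma aux_bm_integrable (hB : IsBrownianMotion P B) (t : ℝ) (ht : 0 ≤ t) (φ : Euc d → ℝ)
    (hφ : Continuous φ) (h : Integrable (fun z => φ (Real.sqrt t • z)) (_root_.stdGaussian d)) :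
    Integrable (fun ω => φ (B t ω)) P := by
  have : Integrable φ (Measure.map (B t) P) := by
    rw [aux_bm_law hB t ht, integrable_map_measure hφ.aestronglyMeasurable (by fun_prop)]
    exact h
  rwa [integrable_map_measure hφ.aestronglyMeasurable (hB.1 t).aemeasurable] at this

lemma aux_bm_sq (hB : IsBrownianMotion P B) (t : ℝ) (ht : 0 ≤ t) :
    Integrable (fun ω => ‖B t ω‖ ^ 2) P ∧
    ∫ ω, ‖B t ω‖ ^ 2 ∂P = t * ∫ z, ‖z‖ ^ 2 ∂(_root_.stdGaussian d) := by
  have e : ∀ z : Euc d, ‖Real.sqrt t • z‖ ^ 2 = t * ‖z‖ ^ 2 := by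
    intro z
    rw [norm_smul, mul_pow, Real.norm_of_nonneg (Real.sqrt_nonneg _), Real.sq_sqrt ht]
  constructor
  · apply aux_bm_integrable hB t ht (fun z => ‖z‖ ^ 2) (by fun_prop)
    simp_rw [e]
    exact (aux_gauss_sq d).const_mul t
  · rw [aux_bm_int hB t ht (fun z => ‖z‖ ^ 2) (by fun_prop)]
    simp_rw [e]
    exact integral_const_mul _ _

lemma aux_bm_mean (hB : IsBrownianMotion P B) (t : ℝ) (ht : 0 ≤ t) (l : Euc d →L[ℝ] ℝ) :
    ∫ ω, l (B t ω) ∂P = 0 := by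
  rw [aux_bm_int hB t ht l l.continuous]
  simp_rw [map_smul, smul_eq_mul]
  rw [integral_const_mul, aux_gauss_mean, mul_zero]

lemma aux_fub [IsProbabilityMeasure P] (hB : IsBrownianMotion P B) (γ : ℝ) (hγ : 0 < γ)
    (φ : Euc d → ℝ) (hφ : Continuous φ) (c : ℝ) (hc : 0 ≤ c)
    (hb : ∀ z, |φ z| ≤ c * (1 + ‖z‖ ^ 2)) :
    Integrable (fun ω => ∫ s in (0:ℝ)..γ, φ (B s ω)) P ∧
    ∫ ω, (∫ s in (0:ℝ)..γ, φ (B s ω)) ∂P = ∫ s in (0:ℝ)..γ, (∫ ω, φ (B s ω) ∂P) := by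
  classical
  set σ := ∫ z, ‖z‖ ^ 2 ∂(_root_.stdGaussian d) with hσ
  have hσ0 : 0 ≤ σ := integral_nonneg fun z => by positivity
  obtain ⟨G, hG, hGm, hGP⟩ : ∃ G : Set Ω, (∀ ω ∈ G, Continuous fun t => B t ω) ∧ MeasurableSet G
      ∧ ∀ᵐ ω ∂P, ω ∈ G := by
    have h2 : {ω | Continuous fun t => B t ω} ∈ ae P := by
      filter_upwards [hB.2.1] with ω hω using hω.2
    obtain ⟨G, hG1, hG2, hG3⟩ := exists_measurable_superset_of_null (mem_ae_iff.1 h2)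
    refine ⟨Gᶜ, fun ω hω => ?_, hG2.compl, ?_⟩
    · by_contra hcon
      exact hω (hG1 hcon)
    · rw [ae_iff]; simpa using hG3
  set Bt : ℝ → Ω → Euc d := fun s ω => if ω ∈ G then B s ω else 0 with hBt
  have hBtm : ∀ s, Measurable (Bt s) := fun s => Measurable.ite hGm (hB.1 s) measurable_const
  have hBtc : ∀ ω, Continuous fun s => Bt s ω := by
    intro ω
    by_cases h : ω ∈ G
    · simp only [hBt, h, if_true]; exact hG ω h
    · simp only [hBt, h, if_false]; exact continuous_const
  have hBte : ∀ᵐ ω ∂P, ∀ s, Bt s ω = B s ω := by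
    filter_upwards [hGP] with ω hω s
    simp [hBt, hω]
  have hjm : Measurable (Function.uncurry Bt) := by
    have := measurable_uncurry_of_continuous_of_measurable (u := fun (s : ℝ) (ω : Ω) => Bt s ω)
      hBtc hBtm
    exact this
  set μ := (volume : Measure ℝ).restrict (Set.Ioc 0 γ) with hμ
  have hFm : Measurable (fun p : ℝ × Ω => φ (Bt p.1 p.2)) := hφ.measurable.comp hjm
  have hs : ∀ s ∈ Set.Ioc 0 γ, Integrable (fun ω => φ (Bt s ω)) P ∧
      ∫ ω, ‖φ (Bt s ω)‖ ∂P ≤ c * (1 + γ * σ) := by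
    intro s hs
    obtain ⟨i1, i2⟩ := aux_bm_sq hB s hs.1.le
    have i1' : Integrable (fun ω => ‖Bt s ω‖ ^ 2) P := i1.congr (by
      filter_upwards [hBte] with ω hω
      rw [hω])
    have i2' : ∫ ω, ‖Bt s ω‖ ^ 2 ∂P = s * σ := by
      rw [hσ, ← i2]; apply integral_congr_ae
      filter_upwards [hBte] with ω hω
      rw [hω]
    have i3 : Integrable (fun ω => c * (1 + ‖Bt s ω‖ ^ 2)) P :=
      ((integrable_const _).add i1').const_mul c
    have i4 : Integrable (fun ω => φ (Bt s ω)) P := by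
      refine i3.mono' (hφ.measurable.comp (hBtm s)).aestronglyMeasurable ?_
      exact Eventually.of_forall fun ω => hb _
    refine ⟨i4, ?_⟩
    calc ∫ ω, ‖φ (Bt s ω)‖ ∂P ≤ ∫ ω, c * (1 + ‖Bt s ω‖ ^ 2) ∂P :=
          integral_mono i4.norm i3 fun ω => hb _
      _ = c * (1 + s * σ) := by
          rw [integral_const_mul, integral_add (integrable_const _) i1', i2']; simp
      _ ≤ _ := by have := hs.2; gcongr
  have hint : Integrable (fun p : ℝ × Ω => φ (Bt p.1 p.2)) (μ.prod P) := by
    rw [integrable_prod_iff hFm.aestronglyMeasurable]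
    constructor
    · rw [hμ, ae_restrict_iff' measurableSet_Ioc]
      exact Eventually.of_forall fun s h => (hs s h).1
    · refine (integrable_const (c * (1 + γ * σ))).mono'
        (hFm.norm.stronglyMeasurable.integral_prod_right'.aestronglyMeasurable) ?_
      rw [hμ, ae_restrict_iff' measurableSet_Ioc]
      refine Eventually.of_forall fun s h => ?_
      rw [Real.norm_of_nonneg (integral_nonneg fun _ => norm_nonneg _)]
      exact (hs s h).2
  have e1 : (fun ω => ∫ s in (0:ℝ)..γ, φ (B s ω)) =ᵐ[P] fun ω => ∫ s, φ (Bt s ω) ∂μ := by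
    filter_upwards [hBte] with ω hω
    simp_rw [hω]
    rw [intervalIntegral.integral_of_le hγ.le]
  constructor
  · exact (hint.integral_prod_right).congr e1.symm
  · rw [integral_congr_ae e1, intervalIntegral.integral_of_le hγ.le,
      ← integral_integral_swap (f := fun s ω => φ (Bt s ω)) hint]
    apply integral_congr_ae
    refine Eventually.of_forall fun s => ?_
    apply integral_congr_ae
    filter_upwards [hBte] with ω hω
    rw [hω]

lemma aux_fub_sq [IsProbabilityMeasure P] (hB : IsBrownianMotion P B) (γ : ℝ) (hγ : 0 < γ) :
    Integrable (fun ω => ∫ s in (0:ℝ)..γ, ‖B s ω‖ ^ 2) P ∧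
    ∫ ω, (∫ s in (0:ℝ)..γ, ‖B s ω‖ ^ 2) ∂P ≤ γ ^ 2 * ∫ z, ‖z‖ ^ 2 ∂(_root_.stdGaussian d) := by
  set σ := ∫ z, ‖z‖ ^ 2 ∂(_root_.stdGaussian d) with hσ
  have hσ0 : 0 ≤ σ := integral_nonneg fun z => by positivity
  obtain ⟨h1, h2⟩ := aux_fub hB γ hγ (fun z => ‖z‖ ^ 2) (by fun_prop) 1 zero_le_one
    (fun z => by rw [abs_of_nonneg (by positivity)]; linarith)
  refine ⟨h1, ?_⟩
  rw [h2]
  have e : ∫ s in (0:ℝ)..γ, (∫ ω, ‖B s ω‖ ^ 2 ∂P) = ∫ s in (0:ℝ)..γ, s * σ := by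
    apply intervalIntegral.integral_congr
    intro s hs
    rw [Set.uIcc_of_le hγ.le] at hs
    exact (aux_bm_sq hB s hs.1).2
  rw [e, intervalIntegral.integral_mul_const, integral_id]
  have : 0 ≤ γ ^ 2 * σ := by positivity
  nlinarith

lemma aux_fub_lin [IsProbabilityMeasure P] (hB : IsBrownianMotion P B) (γ : ℝ) (hγ : 0 < γ)
    (l : Euc d →L[ℝ] ℝ) :
    Integrable (fun ω => ∫ s in (0:ℝ)..γ, l (B s ω)) P ∧
    ∫ ω, (∫ s in (0:ℝ)..γ, l (B s ω)) ∂P = 0 := by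
  obtain ⟨h1, h2⟩ := aux_fub hB γ hγ l l.continuous ‖l‖ (norm_nonneg _)
    (fun z => (l.le_opNorm z).trans (by
      gcongr; nlinarith [sq_nonneg (‖z‖ - 1), norm_nonneg z]))
  refine ⟨h1, ?_⟩
  have e : ∫ s in (0:ℝ)..γ, (∫ ω, l (B s ω) ∂P) = ∫ s in (0:ℝ)..γ, (0:ℝ) := by
    apply intervalIntegral.integral_congr
    intro s hs
    rw [Set.uIcc_of_le hγ.le] at hs
    exact aux_bm_mean hB s hs.1 l
  rw [h2, e, intervalIntegral.integral_zero]
end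

lemma aux_bern_prob (K : ℕ) (hK : 1 ≤ K) : IsProbabilityMeasure (bern (K : ℝ≥0∞)⁻¹) := by
  constructor
  have : (K : ℝ≥0∞)⁻¹ ≤ 1 := by
    rw [ENNReal.inv_le_one]; exact_mod_cast hK
  simp [bern, add_tsub_cancel_of_le this]

lemma aux_bern_ae (p : ℝ≥0∞) : ∀ᵐ h ∂(bern p), |h| ≤ 1 := by
  have hm : MeasurableSet {h : ℝ | |h| ≤ 1} := measurableSet_le (by fun_prop) (by fun_prop)
  rw [bern, ae_add_measure_iff]
  constructor
  · exact Measure.ae_smul_measure ((ae_dirac_iff hm).2 (by simp)) _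
  · exact Measure.ae_smul_measure ((ae_dirac_iff hm).2 (by simp)) _

section
variable {Ω : Type} [MeasurableSpace Ω] {d K : ℕ} {P : Measure Ω}
  {H : Fin K → Ω → ℝ} {ξ : Fin K → Ω → Euc d}

lemma aux_noise (hK : 1 ≤ K) [IsProbabilityMeasure P]
    (h : Measure.map (fun ω => ((fun i => H i ω), fun i => ξ i ω)) P =
            (Measure.pi fun _ : Fin K => bern (K : ℝ≥0∞)⁻¹).prod
              (Measure.pi fun _ : Fin K => _root_.stdGaussian d)) :
    (∀ i, AEMeasurable (H i) P) ∧ (∀ i, AEMeasurable (ξ i) P) ∧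
    (∀ᵐ ω ∂P, ∀ i, |H i ω| ≤ 1) ∧
    (∀ i, Integrable (fun ω => ‖ξ i ω‖ ^ 2) P ∧
      ∫ ω, ‖ξ i ω‖ ^ 2 ∂P = ∫ z, ‖z‖ ^ 2 ∂(_root_.stdGaussian d)) ∧
    (∀ i (l : Euc d →L[ℝ] ℝ), Integrable (fun ω => H i ω * l (ξ i ω)) P ∧
      ∫ ω, H i ω * l (ξ i ω) ∂P = 0) := by
  haveI := aux_bern_prob K hK
  set ν1 := Measure.pi fun _ : Fin K => bern (K : ℝ≥0∞)⁻¹ with hν1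
  set ν2 := Measure.pi fun _ : Fin K => _root_.stdGaussian d with hν2
  have hm : AEMeasurable (fun ω => ((fun i => H i ω), fun i => ξ i ω)) P := by
    by_contra hcon
    rw [Measure.map_of_not_aemeasurable hcon] at h
    have : IsProbabilityMeasure (ν1.prod ν2) := inferInstance
    rw [← h] at this
    exact IsProbabilityMeasure.ne_zero (0 : Measure ((Fin K → ℝ) × (Fin K → Euc d))) rfl
  have mp1 : ∀ i, MeasurePreserving (Function.eval i) ν1 (bern (K : ℝ≥0∞)⁻¹) :=
    fun i => measurePreserving_eval _ i
  have mp2 : ∀ i, MeasurePreserving (Function.eval i) ν2 (_root_.stdGaussian d) :=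
    fun i => measurePreserving_eval _ i
  have mf : MeasurePreserving Prod.fst (ν1.prod ν2) ν1 := measurePreserving_fst
  have ms : MeasurePreserving Prod.snd (ν1.prod ν2) ν2 := measurePreserving_snd
  have tr : ∀ φ : (Fin K → ℝ) × (Fin K → Euc d) → ℝ, Measurable φ → Integrable φ (ν1.prod ν2) →
      Integrable (fun ω => φ ((fun i => H i ω), fun i => ξ i ω)) P ∧
      ∫ ω, φ ((fun i => H i ω), fun i => ξ i ω) ∂P = ∫ p, φ p ∂(ν1.prod ν2) := by
    intro φ hφ hi
    rw [← h] at hi ⊢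
    rw [integral_map hm hφ.aestronglyMeasurable]
    rw [integrable_map_measure hφ.aestronglyMeasurable hm] at hi
    exact ⟨hi, rfl⟩
  have bi : Integrable (fun h : ℝ => h) (bern (K : ℝ≥0∞)⁻¹) :=
    (integrable_const (1:ℝ)).mono' (by fun_prop) (aux_bern_ae _)
  refine ⟨fun i => ?_, fun i => ?_, ?_, fun i => ?_, fun i l => ?_⟩
  · exact (by fun_prop : Measurable fun p : (Fin K → ℝ) × (Fin K → Euc d) => p.1 i).comp_aemeasurable hm
  · exact (by fun_prop : Measurable fun p : (Fin K → ℝ) × (Fin K → Euc d) => p.2 i).comp_aemeasurable hm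
  · have : ∀ᵐ p ∂(ν1.prod ν2), ∀ i, |p.1 i| ≤ 1 := by
      rw [ae_all_iff]
      intro i
      exact ((mp1 i).comp mf).quasiMeasurePreserving.ae (aux_bern_ae _)
    rw [← h] at this
    exact ae_of_ae_map hm this
  · have mp := (mp2 i).comp ms
    have i1 : Integrable (fun p : (Fin K → ℝ) × (Fin K → Euc d) => ‖p.2 i‖ ^ 2) (ν1.prod ν2) :=
      mp.integrable_comp_of_integrable (aux_gauss_sq d)
    obtain ⟨a1, a2⟩ := tr (fun p => ‖p.2 i‖ ^ 2) (by fun_prop) i1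
    refine ⟨a1, a2.trans ?_⟩
    have := integral_map (μ := ν1.prod ν2) mp.measurable.aemeasurable (f := fun z : Euc d => ‖z‖ ^ 2)
      (by fun_prop)
    rw [mp.map_eq] at this
    exact this.symm
  · have j1 : Integrable (fun p : Fin K → ℝ => p i) ν1 := (mp1 i).integrable_comp_of_integrable bi
    have j2 : Integrable (fun p : Fin K → Euc d => l (p i)) ν2 :=
      (mp2 i).integrable_comp_of_integrable (aux_gauss_lin d l)
    obtain ⟨a1, a2⟩ := tr (fun p => p.1 i * l (p.2 i)) (by fun_prop) (j1.mul_prod j2)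
    refine ⟨a1, a2.trans ?_⟩
    rw [integral_prod_mul (fun p : Fin K → ℝ => p i) (fun p : Fin K → Euc d => l (p i))]
    have := integral_map (μ := ν2) (mp2 i).measurable.aemeasurable (f := fun z : Euc d => l z)
      (by fun_prop)
    rw [(mp2 i).map_eq, aux_gauss_mean] at this
    rw [show (∫ p : Fin K → Euc d, l (p i) ∂ν2) = 0 from this.symm, mul_zero]
end

section
variable {Ω : Type} [MeasurableSpace Ω] {d K : ℕ} {P : Measure Ω}

lemma aux_lin_meas {E : Type*} [NormedAddCommGroup E] [NormedSpace ℝ E] [MeasurableSpace E]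
    [BorelSpace E] [SecondCountableTopology E] (a : E) (b γ : ℝ) (S T : Ω → E) (hS : AEMeasurable S P)
    (hT : AEMeasurable T P) : AEMeasurable (fun ω => a + γ • S ω + b • T ω) P := by
  have c : Continuous (fun g : E × E => a + γ • g.1 + b • g.2) := by fun_prop
  exact c.measurable.comp_aemeasurable (hS.prodMk hT)

lemma aux_Ymeas (U : Euc d → ℝ) (gm : Measurable (gradient U)) (γ : ℝ) (x : Euc d)
    (B : ℝ → Ω → Euc d) (H : Fin K → Ω → ℝ) (ξ : Fin K → Ω → Euc d)
    (hB : Measurable (B γ)) (Hm : ∀ i, AEMeasurable (H i) P) (ξm : ∀ i, AEMeasurable (ξ i) P) :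
    AEMeasurable (fun ω => oneStepPRLMC U γ K x B H ξ ω) P := by
  have h1 : ∀ i : Fin K, AEMeasurable (fun ω => prlmcMid U γ K x (fun j => ξ j ω) i) P := by
    intro i
    have c : Continuous (fun g : Euc d => x - (((i : ℝ) * γ / (K : ℝ)) • gradient U x) +
      Real.sqrt (2 * (i : ℝ) * γ / (K : ℝ)) • g) := by fun_prop
    exact c.measurable.comp_aemeasurable (ξm i)
  have h2 : ∀ i : Fin K, AEMeasurable (fun ω => H i ω •
      (gradient U x - gradient U (prlmcMid U γ K x (fun j => ξ j ω) i))) P := by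
    intro i
    have c : Continuous (fun g : ℝ × Euc d => g.1 • (gradient U x - g.2)) := by fun_prop
    exact c.measurable.comp_aemeasurable ((Hm i).prodMk (gm.comp_aemeasurable (h1 i)))
  have h3 := Finset.aemeasurable_fun_sum Finset.univ fun i _ => h2 i
  exact aux_lin_meas _ _ _ _ _ h3 hB.aemeasurable
end

set_option maxHeartbeats 4000000 in
/-- Under Assumptions 1 and 3, the one-step weak error between the Langevin
diffusion and the Poisson randomized midpoint scheme satisfies
`|E f(X_γ^x) − E f(Ỹ_γ^x)| ≤ C (1 + |x|²)(‖∇f‖ + ‖∇²f‖) γ²` with `C` independent of `γ`. -/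
theorem stmt15 (d K : ℕ) (hK : 1 ≤ K) (m L Lt : ℝ) (γ₁ : ℝ)
    (hγ₁ : γ₁ ∈ Set.Ioo (0 : ℝ) 1) (U : Euc d → ℝ)
    (hU : StrongAssumption U m L) (hU3 : ThirdDerivBounded U Lt) :
    ∃ C > (0 : ℝ), ∀ γ : ℝ, 0 < γ → γ ≤ γ₁ →
      ∀ (x : Euc d) (Ω : Type) (_ : MeasurableSpace Ω) (P : Measure Ω),
        IsProbabilityMeasure P →
        ∀ (B X : ℝ → Ω → Euc d) (H : Fin K → Ω → ℝ) (ξ' : Fin K → Ω → Euc d),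
          IsBrownianMotion P B → SolvesLangevin U P B X x →
          Measure.map (fun ω => ((fun i => H i ω), fun i => ξ' i ω)) P =
            (Measure.pi fun _ : Fin K => bern (K : ℝ≥0∞)⁻¹).prod
              (Measure.pi fun _ : Fin K => stdGaussian d) →
          IndepFun (fun ω => ((fun i => H i ω), fun i => ξ' i ω))
            (fun ω => fun s : ℝ => B s ω) P →
          ∀ (f : Euc d → ℝ) (M1 M2 : ℝ), ContDiff ℝ 2 f →
            (∀ y, ‖gradient f y‖ ≤ M1) → (∀ y, ‖iteratedFDeriv ℝ 2 f y‖ ≤ M2) →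
            |(∫ ω, f (X γ ω) ∂P) - ∫ ω, f (oneStepPRLMC U γ K x B H ξ' ω) ∂P| ≤
              C * (1 + ‖x‖ ^ 2) * (M1 + M2) * γ ^ 2 := by
  obtain ⟨hU1, hm, hmL, hq, hg0⟩ := hU
  obtain ⟨hU3c, hU3b⟩ := hU3
  have hL : 0 ≤ L := (hm.trans_le hmL).le
  have hLt : 0 ≤ Lt := (norm_nonneg _).trans (hU3b 0)
  have gl : ∀ y z, ‖gradient U y - gradient U z‖ ≤ L * ‖y - z‖ :=
    fun y z => aux_grad_lip U m L hm hmL hq z y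
  have g0 : ∀ y, ‖gradient U y‖ ≤ L * ‖y‖ := by
    intro y
    have := gl y 0
    rwa [hg0, sub_zero, sub_zero] at this
  have gc : Continuous (gradient U) := by
    have : LipschitzWith ⟨L, hL⟩ (gradient U) := LipschitzWith.of_dist_le_mul fun y z => by
      rw [dist_eq_norm, dist_eq_norm]; exact gl y z
    exact this.continuous
  obtain ⟨cX, hcX, HX⟩ := aux_pathX (E := Euc d) L Lt hL hLt
  obtain ⟨cY, hcY, HY⟩ := aux_stepY (E := Euc d) K L Lt hL hLt
  set σ := ∫ z, ‖z‖ ^ 2 ∂(_root_.stdGaussian d) with hσ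
  have hσ0 : 0 ≤ σ := integral_nonneg fun z => by positivity
  refine ⟨5 * (cX + cY) * (1 + 2 * σ + K * σ) + 1, by positivity, ?_⟩
  intro γ hγ hγ2 x Ω mΩ P hP B X H ξ hB hX hlaw _ f M1 M2 hf hf1 hf2
  have hγ1 : γ ≤ 1 := hγ2.trans hγ₁.2.le
  have hM1 : 0 ≤ M1 := (norm_nonneg _).trans (hf1 0)
  have hM2 : 0 ≤ M2 := (norm_nonneg _).trans (hf2 0)
  have hf1' : ∀ y, ‖fderiv ℝ f y‖ ≤ M1 := fun y => by rw [aux_grad_norm]; exact hf1 y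
  obtain ⟨A, hA, hAt⟩ := aux_grad_taylor U Lt L hL hU3c hU3b gl x
  obtain ⟨Hm, ξm, H1, ξ2, Hξ⟩ := aux_noise hK hlaw
  obtain ⟨T1, T2⟩ := aux_fub_sq hB γ hγ
  obtain ⟨B1, B2⟩ := aux_bm_sq hB γ hγ.le
  set l : Euc d →L[ℝ] ℝ := (fderiv ℝ f x).comp A with hl
  obtain ⟨l1, l2⟩ := aux_fub_lin hB γ hγ l
  set Q : Ω → ℝ := fun ω => (1 + ‖x‖ ^ 2) * (γ ^ 2 + (∫ s in (0:ℝ)..γ, ‖B s ω‖ ^ 2)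
    + γ * ‖B γ ω‖ ^ 2 + γ ^ 2 * ∑ i, ‖ξ i ω‖ ^ 2) with hQ
  set N : Ω → ℝ := fun ω => (∑ i : Fin K, (γ * Real.sqrt (2 * (i : ℝ) * γ / (K : ℝ))) *
    (H i ω * l (ξ i ω))) - Real.sqrt 2 * ∫ s in (0:ℝ)..γ, l (B s ω) with hN
  have iZ : Integrable (fun ω => ∑ i, ‖ξ i ω‖ ^ 2) P :=
    integrable_finsetSum _ fun i _ => (ξ2 i).1
  have iQ : Integrable Q P :=
    ((((integrable_const _).add T1).add (B1.const_mul γ)).add (iZ.const_mul _)).const_mul _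
  have eQ : ∫ ω, Q ω ∂P ≤ (1 + ‖x‖ ^ 2) * (γ ^ 2 * (1 + 2 * σ + K * σ)) := by
    have e1 : ∫ ω, ∑ i, ‖ξ i ω‖ ^ 2 ∂P = K * σ := by
      rw [integral_finsetSum _ fun i _ => (ξ2 i).1]
      simp_rw [fun i => (ξ2 i).2]
      simp [hσ]
    simp only [hQ]
    have j1 : Integrable (fun ω => γ ^ 2 + (∫ s in (0:ℝ)..γ, ‖B s ω‖ ^ 2)) P :=
      (integrable_const _).add T1
    have j2 : Integrable (fun ω => γ ^ 2 + (∫ s in (0:ℝ)..γ, ‖B s ω‖ ^ 2) + γ * ‖B γ ω‖ ^ 2) P :=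
      j1.add (B1.const_mul γ)
    rw [integral_const_mul, integral_add j2 (iZ.const_mul _), integral_add j1 (B1.const_mul γ),
      integral_add (integrable_const _) T1, integral_const_mul, integral_const_mul, e1, B2]
    refine mul_le_mul_of_nonneg_left ?_ (by positivity)
    simp only [integral_const, probReal_univ, one_smul]
    linarith
  have iNs : ∀ i : Fin K, Integrable (fun ω => (γ * Real.sqrt (2 * (i : ℝ) * γ / (K : ℝ))) *
    (H i ω * l (ξ i ω))) P := fun i => (Hξ i l).1.const_mul _
  have iN : Integrable N P :=
    (integrable_finsetSum _ fun i _ => iNs i).sub (l1.const_mul _)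
  have eN : ∫ ω, N ω ∂P = 0 := by
    simp only [hN]
    rw [integral_sub (integrable_finsetSum _ fun i _ => iNs i) (l1.const_mul _),
      integral_finsetSum _ fun i _ => iNs i, integral_const_mul, l2]
    simp_rw [integral_const_mul, fun i => (Hξ i l).2]
    simp
  set Y : Ω → Euc d := fun ω => oneStepPRLMC U γ K x B H ξ ω with hY
  have key : ∀ᵐ ω ∂P, γ * ‖X γ ω - x‖ ^ 2 ≤ (cX + cY) * Q ω ∧
      γ * ‖Y ω - x‖ ^ 2 ≤ (cX + cY) * Q ω ∧
      |f (X γ ω) - f (Y ω) - N ω| ≤ 5 * (M1 + M2) * ((cX + cY) * Q ω) := by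
    filter_upwards [hB.2.1, hX.2, H1] with ω hBω hXω hHω
    obtain ⟨x1, x2, x3⟩ := HX (gradient U) A x γ (fun s => B s ω) (fun s => X s ω) gl g0 hA hAt hγ
      hγ1 hBω.2 hXω.1 gc hXω.2
    set T := ∫ s in (0:ℝ)..γ, ‖B s ω‖ ^ 2 with hT
    have hT0 : 0 ≤ T := intervalIntegral.integral_nonneg hγ.le (fun s _ => sq_nonneg _)
    have hZ0 : 0 ≤ ∑ i, ‖ξ i ω‖ ^ 2 := Finset.sum_nonneg fun i _ => sq_nonneg _
    have hQ0 : 0 ≤ Q ω := by simp only [hQ, ← hT]; positivity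
    have q1 : (1 + ‖x‖ ^ 2) * (γ ^ 2 + T + γ * ‖B γ ω‖ ^ 2) ≤ Q ω := by
      simp only [hQ, ← hT]
      refine mul_le_mul_of_nonneg_left ?_ (by positivity)
      have : 0 ≤ γ ^ 2 * ∑ i, ‖ξ i ω‖ ^ 2 := by positivity
      linarith
    have q2 : (1 + ‖x‖ ^ 2) * (γ ^ 2 + γ * ‖B γ ω‖ ^ 2 + γ ^ 2 * ∑ i, ‖ξ i ω‖ ^ 2) ≤ Q ω := by
      simp only [hQ, ← hT]
      refine mul_le_mul_of_nonneg_left ?_ (by positivity)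
      linarith
    obtain ⟨y1, y2, y3⟩ := HY (gradient U) A x γ (B γ ω) (fun i => H i ω) (fun i => ξ i ω)
      (fun i => prlmcMid U γ K x (fun j => ξ j ω) i)
      (γ • ∑ i : Fin K, H i ω •
        (gradient U x - gradient U (prlmcMid U γ K x (fun j => ξ j ω) i))) (Q ω)
      gl g0 hA hAt hγ hγ1 hHω (fun i => rfl) rfl q2
    set DY := γ • ∑ i : Fin K, H i ω •
        (gradient U x - gradient U (prlmcMid U γ K x (fun j => ξ j ω) i)) with hDY
    have eY : Y ω = x - γ • gradient U x + DY + Real.sqrt 2 • B γ ω := rfl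
    have r1 : cX * ((1 + ‖x‖ ^ 2) * (γ ^ 2 + T + γ * ‖B γ ω‖ ^ 2)) ≤ (cX + cY) * Q ω := by
      have : cX * ((1 + ‖x‖ ^ 2) * (γ ^ 2 + T + γ * ‖B γ ω‖ ^ 2)) ≤ cX * Q ω := by gcongr
      nlinarith
    have r2 : cY * Q ω ≤ (cX + cY) * Q ω := by nlinarith
    have k1 : γ * ‖X γ ω - x‖ ^ 2 ≤ (cX + cY) * Q ω := x1.trans r1
    have k2 : γ * ‖Y ω - x‖ ^ 2 ≤ (cX + cY) * Q ω := by rw [eY]; exact y1.trans r2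
    refine ⟨k1, k2, ?_⟩
    have := aux_comb f hf M1 M2 hf1' hf2 x (X γ ω) (Y ω)
      (x - γ • gradient U x + Real.sqrt 2 • B γ ω)
      (X γ ω - (x - γ • gradient U x + Real.sqrt 2 • B γ ω)) DY _ _ γ ((cX + cY) * Q ω) hγ k1 k2
      (x2.trans (mul_le_mul_of_nonneg_left r1 hγ.le))
      (y2.trans (mul_le_mul_of_nonneg_left r2 hγ.le)) (by abel) (by rw [eY]; abel)
      (x3.trans r1) (y3.trans r2)
    convert this using 3
    simp only [hN]
    rw [← map_sub]
    change _ = l _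
    rw [map_sub, map_smul, map_sum, ← ContinuousLinearMap.intervalIntegral_comp_comm l
      (hBω.2.intervalIntegrable _ _)]
    simp only [map_smul, smul_eq_mul]
  have hYm : AEMeasurable Y P :=
    aux_Ymeas U gc.measurable γ x B H ξ (hB.1 γ) Hm ξm
  have dom : Integrable (fun ω => ‖f x‖ + M1 * (1 + (cX + cY) * Q ω / γ)) P :=
    (integrable_const _).add (((integrable_const _).add ((iQ.const_mul _).div_const γ)).const_mul _)
  have ifX : Integrable (fun ω => f (X γ ω)) P := by
    refine dom.mono' (hf.continuous.measurable.comp (hX.1 γ)).aestronglyMeasurable ?_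
    filter_upwards [key] with ω hω
    exact aux_lip f hf M1 hf1' x _ γ _ hγ hω.1
  have ifY : Integrable (fun ω => f (Y ω)) P := by
    refine dom.mono' (hf.continuous.measurable.comp_aemeasurable hYm).aestronglyMeasurable ?_
    filter_upwards [key] with ω hω
    exact aux_lip f hf M1 hf1' x _ γ _ hγ hω.2.1
  have e : (∫ ω, f (X γ ω) ∂P) - ∫ ω, f (Y ω) ∂P = ∫ ω, (f (X γ ω) - f (Y ω) - N ω) ∂P := by
    have iD : Integrable (fun ω => f (X γ ω) - f (Y ω)) P := ifX.sub ifY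
    rw [integral_sub iD iN, eN, sub_zero, integral_sub ifX ifY]
  change |(∫ ω, f (X γ ω) ∂P) - ∫ ω, f (Y ω) ∂P| ≤ _
  rw [e]
  calc |∫ ω, (f (X γ ω) - f (Y ω) - N ω) ∂P|
      ≤ ∫ ω, 5 * (M1 + M2) * ((cX + cY) * Q ω) ∂P := by
        rw [← Real.norm_eq_abs]
        refine norm_integral_le_of_norm_le ((iQ.const_mul _).const_mul _) ?_
        filter_upwards [key] with ω hω
        rw [Real.norm_eq_abs]
        exact hω.2.2
    _ = 5 * (M1 + M2) * ((cX + cY) * ∫ ω, Q ω ∂P) := by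
        rw [integral_const_mul, integral_const_mul]
    _ ≤ 5 * (M1 + M2) * ((cX + cY) * ((1 + ‖x‖ ^ 2) * (γ ^ 2 * (1 + 2 * σ + K * σ)))) := by
        gcongr
    _ ≤ (5 * (cX + cY) * (1 + 2 * σ + K * σ) + 1) * (1 + ‖x‖ ^ 2) * (M1 + M2) * γ ^ 2 := by
        have : 0 ≤ (1 + ‖x‖ ^ 2) * (M1 + M2) * γ ^ 2 := by positivity
        linarith

end
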